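/- Let P and Q be nonzero integers with D = P^2 - 4Q ≠ 0, let U = U(P,Q) be nondegenerate, and let p be a prime with p ∤ D and p ∤ gcd(P,Q). Let n > 1 satisfy gcd(p,n) = 1 and suppose n is not the entry point of p in U, i.e. it is not the case that p ∣ U_n and p ∤ U_m for all 1 ≤ m < n. Then for every integer k ≥ 1 there exists an integer t such that M^U_{p^k n} = 1 + p^k·t. -/

import Mathlib

/-- Lucas sequence of the first kind: `U 0 = 0`, `U 1 = 1`,
`U (n+2) = P * U (n+1) - Q * U n`. -/
def lucasU (P Q : ℤ) : ℕ → ℤ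
  | 0 => 0
  | 1 => 1
  | n + 2 => P * lucasU P Q (n + 1) - Q * lucasU P Q n

/-- Möbius dual of the Lucas sequence of the first kind:
`M^U_n = ∏_{d ∣ n} U_d ^ μ(n/d)`, as a rational number. -/
def mobiusDualU (P Q : ℤ) (n : ℕ) : ℚ :=
  ∏ d ∈ n.divisors, (lucasU P Q d : ℚ) ^ (ArithmeticFunction.moebius (n / d))

open Polynomial in
/-- Homogenized cyclotomic polynomial evaluated at `(x, y)`. -/
noncomputable def homCyc (n : ℕ) {R : Type*} [CommRing R] (x y : R) : R :=
  ∑ i ∈ Finset.range (n.totient + 1),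
    (((cyclotomic n ℤ).coeff i : ℤ) : R) * x ^ i * y ^ (n.totient - i)

lemma homCyc_map (n : ℕ) {R S : Type*} [CommRing R] [CommRing S] (f : R →+* S) (x y : R) :
    f (homCyc n x y) = homCyc n (f x) (f y) := by
  simp [homCyc]

open Polynomial in
lemma homCyc_field (n : ℕ) {K : Type*} [Field K] (x y : K) (hy : y ≠ 0) :
    homCyc n x y = y ^ n.totient * (cyclotomic n K).eval (x / y) := by
  rw [eval_eq_sum_range, natDegree_cyclotomic, Finset.mul_sum, homCyc]
  refine Finset.sum_congr rfl fun i hi => ?_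
  rw [← map_cyclotomic_int n K, coeff_map]
  have hi' : i ≤ n.totient := by
    have := Finset.mem_range.mp hi
    omega
  obtain ⟨j, hj⟩ := Nat.exists_eq_add_of_le hi'
  rw [hj, Nat.add_sub_cancel_left, div_pow, pow_add]
  simp only [eq_intCast]
  field_simp

open Polynomial in
lemma cyclotomic_reverse_aux (n : ℕ) (hn : 1 < n) :
    (cyclotomic n ℤ).reverse = cyclotomic n ℤ := by
  have h0 : (cyclotomic n ℤ).coeff 0 = 1 := cyclotomic_coeff_zero ℤ hn
  have hpos : 0 < n := by omega
  have hz := Complex.isPrimitiveRoot_exp n hpos.ne'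
  set ζ := Complex.exp (2 * Real.pi * Complex.I / n)
  have hmr : (cyclotomic n ℤ).reverse.Monic := by
    rw [Monic, reverse_leadingCoeff, trailingCoeff, natTrailingDegree_eq_zero.mpr (Or.inr (by simp [h0])), h0]
  have hroot : (cyclotomic n ℤ).eval₂ (Int.castRingHom ℂ) ζ⁻¹ = 0 := by
    rw [eval₂_eq_eval_map, map_cyclotomic_int]
    exact hz.inv.isRoot_cyclotomic hpos
  have hroot2 : (cyclotomic n ℤ).reverse.eval₂ (Int.castRingHom ℂ) ζ = 0 := by
    have hzn : ζ ≠ 0 := hz.ne_zero hpos.ne'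
    let : Invertible ζ⁻¹ := invertibleOfNonzero (inv_ne_zero hzn)
    have := (eval₂_reverse_eq_zero_iff (Int.castRingHom ℂ) ζ⁻¹ (cyclotomic n ℤ)).mpr hroot
    simpa using this
  refine eq_of_monic_of_dvd_of_natDegree_le (cyclotomic.monic n ℤ) hmr ?_ (reverse_natDegree_le _)
  rw [cyclotomic_eq_minpoly hz hpos]
  refine minpoly.isIntegrallyClosed_dvd (hz.isIntegral hpos) ?_
  rw [← cyclotomic_eq_minpoly hz hpos]
  simpa [aeval_def] using hroot2

open Polynomial in
lemma homCyc_symm (n : ℕ) (hn : 1 < n) {R : Type*} [CommRing R] (x y : R) :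
    homCyc n x y = homCyc n y x := by
  unfold homCyc
  rw [← Finset.sum_range_reflect]
  refine Finset.sum_congr rfl fun i hi => ?_
  have hi' : i ≤ n.totient := by
    have := Finset.mem_range.mp hi
    omega
  have e : n.totient + 1 - 1 - i = n.totient - i := by omega
  have e2 : n.totient - (n.totient - i) = i := by omega
  have hc : (cyclotomic n ℤ).coeff (n.totient - i) = (cyclotomic n ℤ).coeff i := by
    conv_rhs => rw [← cyclotomic_reverse_aux n hn]
    rw [coeff_reverse, natDegree_cyclotomic, revAt_le hi']
  rw [e, e2, hc]
  ring

lemma homCyc_congr (n : ℕ) {R : Type*} [CommRing R] (d x y x' y' : R)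
    (hx : d ∣ x - x') (hy : d ∣ y - y') : d ∣ homCyc n x y - homCyc n x' y' := by
  rw [← Ideal.mem_span_singleton, ← Ideal.Quotient.eq] at *
  rw [homCyc_map, homCyc_map, hx, hy]

open Polynomial in
lemma homCyc_prod (n : ℕ) (hn : 0 < n) {K : Type*} [Field K] (x y : K) (hy : y ≠ 0) :
    ∏ d ∈ n.divisors, homCyc d x y = x ^ n - y ^ n := by
  simp_rw [homCyc_field _ x y hy]
  rw [Finset.prod_mul_distrib, Finset.prod_pow_eq_pow_sum, Nat.sum_totient, ← eval_prod,
    prod_cyclotomic_eq_X_pow_sub_one hn]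
  simp only [eval_sub, eval_pow, eval_X, eval_one]
  rw [div_pow, mul_sub, mul_one, mul_div_cancel₀ _ (pow_ne_zero n hy)]

open Polynomial in
lemma cyc_expand_pow (n p : ℕ) (hp : p.Prime) (h : ¬ p ∣ n) (k : ℕ) (R : Type*) [CommRing R] :
    expand R (p ^ (k + 1)) (cyclotomic n R) =
      cyclotomic (p ^ (k + 1) * n) R * expand R (p ^ k) (cyclotomic n R) := by
  induction k with
  | zero => simp [cyclotomic_expand_eq_cyclotomic_mul hp h, mul_comm]
  | succ k ih =>
    rw [pow_succ', expand_mul, ih, map_mul, cyclotomic_expand_eq_cyclotomic hp, ← expand_mul]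
    · rw [← pow_succ']
      congr 2
      ring
    · exact Dvd.intro_left _ rfl |>.mul_right n

open Polynomial in
lemma homCyc_expand (n p : ℕ) (hp : p.Prime) (h : ¬ p ∣ n) (k : ℕ) {K : Type*} [Field K]
    (x y : K) (hy : y ≠ 0) :
    homCyc n (x ^ p ^ (k + 1)) (y ^ p ^ (k + 1)) =
      homCyc (p ^ (k + 1) * n) x y * homCyc n (x ^ p ^ k) (y ^ p ^ k) := by
  have h1 := congrArg (eval (x / y)) (cyc_expand_pow n p hp h k K)
  rw [eval_mul, expand_eval, expand_eval] at h1
  rw [homCyc_field _ _ _ hy, homCyc_field _ _ _ (pow_ne_zero _ hy),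
    homCyc_field _ _ _ (pow_ne_zero _ hy), ← div_pow, ← div_pow, h1, ← pow_mul, ← pow_mul]
  have ht : (p ^ (k + 1) * n).totient + p ^ k * n.totient = p ^ (k + 1) * n.totient := by
    rw [Nat.totient_mul (Nat.Coprime.pow_left _ ((Nat.Prime.coprime_iff_not_dvd hp).mpr h)),
      Nat.totient_prime_pow_succ hp]
    obtain ⟨q, rfl⟩ : ∃ q, p = q + 1 := ⟨p - 1, by have := hp.pos; omega⟩
    simp only [Nat.add_sub_cancel]
    ring
  rw [← ht, pow_add]
  ring

lemma disc_zero {R : Type*} [CommRing R] (P Q : ℤ) (a b : R) (hs : a + b = (P : R))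
    (hm : a * b = (Q : R)) (h : a - b = 0) : ((P ^ 2 - 4 * Q : ℤ) : R) = 0 := by
  push_cast
  rw [← hs, ← hm]
  linear_combination (a - b) * h

lemma lucasU_mul {R : Type*} [CommRing R] (P Q : ℤ) (a b : R) (hs : a + b = (P : R))
    (hm : a * b = (Q : R)) (m : ℕ) :
    (lucasU P Q m : R) * (a - b) = a ^ m - b ^ m := by
  induction m using Nat.twoStepInduction with
  | zero => simp [lucasU]
  | one => simp [lucasU]
  | more m h1 h2 =>
    rw [lucasU]
    push_cast
    rw [← hs, ← hm]
    linear_combination (a + b) * h2 - a * b * h1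

lemma mobiusDualU_eq {K : Type*} [Field K] [CharZero K] (P Q : ℤ) (hQ : Q ≠ 0)
    (hD : P ^ 2 - 4 * Q ≠ 0)
    (hnd : ∀ m : ℕ, 1 ≤ m → lucasU P Q m ≠ 0) (a b : K) (hs : a + b = (P : K))
    (hm : a * b = (Q : K)) (n : ℕ) (hn : 1 < n) :
    ((mobiusDualU P Q n : ℚ) : K) = homCyc n a b := by
  have hQ' : (Q : K) ≠ 0 := by exact_mod_cast hQ
  have hb : b ≠ 0 := by
    rintro rfl
    simp at hm
    exact hQ' hm.symm
  have hab : a - b ≠ 0 := by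
    intro h
    have : ((P ^ 2 - 4 * Q : ℤ) : K) = 0 := by
      push_cast
      rw [← hs, ← hm]
      linear_combination (a - b) * h
    exact hD (by exact_mod_cast this)
  have hU : ∀ m : ℕ, 0 < m → (lucasU P Q m : K) ≠ 0 := fun m hm => by exact_mod_cast hnd m hm
  have hprod : ∀ m : ℕ, 0 < m → ∏ d ∈ m.divisors, homCyc d a b = (lucasU P Q m : K) * (a - b) :=
    fun m hm' => by rw [homCyc_prod m hm' a b hb, lucasU_mul P Q a b hs hm]
  have hH1 : homCyc 1 a b = a - b := by
    have := hprod 1 one_pos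
    simpa [lucasU] using this
  have hH : ∀ m : ℕ, 0 < m → homCyc m a b ≠ 0 := fun m hm' => by
    have h1 := hprod m hm'
    have h2 : ∏ d ∈ m.divisors, homCyc d a b ≠ 0 := by
      rw [h1]
      exact mul_ne_zero (hU m hm') hab
    exact Finset.prod_ne_zero_iff.mp h2 m (Nat.mem_divisors_self m hm'.ne')
  let f : ℕ → K := fun d => if d = 1 then 1 else homCyc d a b
  have key := (ArithmeticFunction.prod_eq_iff_prod_pow_moebius_eq_of_nonzero (f := f)
    (g := fun m => (lucasU P Q m : K)) (fun m hm' => by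
      by_cases h : m = 1
      · simp [f, h]
      · simpa [f, h] using hH m hm') hU).mp (fun m hm' => by
        have h1 := hprod m hm'
        have hmem : 1 ∈ m.divisors := Nat.one_mem_divisors.mpr hm'.ne'
        rw [← Finset.mul_prod_erase _ _ hmem, hH1] at h1
        rw [← Finset.mul_prod_erase _ _ hmem]
        have h2 : ∏ d ∈ m.divisors.erase 1, f d = ∏ d ∈ m.divisors.erase 1, homCyc d a b :=
          Finset.prod_congr rfl fun d hd => by simp [f, Finset.ne_of_mem_erase hd]
        rw [h2]
        simp only [f, if_true, one_mul]
        exact mul_right_cancel₀ hab (by rw [← h1]; ring)) n (by omega)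
  have hf : f n = homCyc n a b := if_neg (by omega)
  rw [← hf, ← key, mobiusDualU]
  push_cast
  rw [Nat.prod_divisorsAntidiagonal' (f := fun i j =>
    (lucasU P Q j : K) ^ (ArithmeticFunction.moebius i))]

/-- The ring `ℤ[X]/(X² - PX + Q)`. -/
abbrev LucasRing (P Q : ℤ) : Type := QuadraticAlgebra ℤ (-Q) P

/-- Evaluation of the Lucas ring at a root. -/
def lucasEval (P Q : ℤ) {K : Type*} [CommRing K] (a b : K) (hs : a + b = (P : K))
    (hm : a * b = (Q : K)) : LucasRing P Q →+* K :=
  (QuadraticAlgebra.lift (R := ℤ) (a := -Q) (b := P) (A := K) ⟨a, by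
    simp [zsmul_eq_mul]
    rw [← hs, ← hm]
    ring⟩ : LucasRing P Q →ₐ[ℤ] K).toRingHom

lemma lucasEval_apply (P Q : ℤ) {K : Type*} [CommRing K] (a b : K) (hs : a + b = (P : K))
    (hm : a * b = (Q : K)) (z : LucasRing P Q) :
    lucasEval P Q a b hs hm z = (z.re : K) + (z.im : K) * a := by
  simp [lucasEval, QuadraticAlgebra.lift, zsmul_eq_mul]

lemma exists_roots (P Q : ℤ) (K : Type*) [Field K] [IsAlgClosed K] :
    ∃ a b : K, a + b = (P : K) ∧ a * b = (Q : K) := by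
  obtain ⟨a, ha⟩ := IsAlgClosed.exists_root
    (Polynomial.X ^ 2 - Polynomial.C (P : K) * Polynomial.X + Polynomial.C (Q : K)) (by
      have : (Polynomial.X ^ 2 - Polynomial.C (P : K) * Polynomial.X
        + Polynomial.C (Q : K)).degree = 2 := by compute_degree!
      rw [this]
      decide)
  refine ⟨a, P - a, by ring, ?_⟩
  simp [Polynomial.IsRoot] at ha
  linear_combination -ha

section main
variable (P Q : ℤ)

/-- generator -/
def omg : LucasRing P Q := ⟨0, 1⟩
/-- conjugate generator -/
def omgb : LucasRing P Q := ⟨P, -1⟩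

lemma eval_omg {K : Type*} [CommRing K] (a b : K) (hs : a + b = (P : K))
    (hm : a * b = (Q : K)) : lucasEval P Q a b hs hm (omg P Q) = a := by
  simp [lucasEval_apply, omg]

lemma eval_omgb {K : Type*} [CommRing K] (a b : K) (hs : a + b = (P : K))
    (hm : a * b = (Q : K)) : lucasEval P Q a b hs hm (omgb P Q) = b := by
  simp [lucasEval_apply, omgb, ← hs]

lemma star_fixed (z : LucasRing P Q) (h : star z = z) : ∃ c : ℤ, z = (c : LucasRing P Q) := by
  refine ⟨z.re, ?_⟩
  have := congrArg QuadraticAlgebra.im h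
  rw [QuadraticAlgebra.im_star] at this
  ext
  · simp
  · simp
    omega

lemma homCyc_int (n : ℕ) (hn : 1 < n) (j : ℕ) :
    ∃ c : ℤ, homCyc n (omg P Q ^ j) (omgb P Q ^ j) = (c : LucasRing P Q) := by
  apply star_fixed
  have h := homCyc_map n (starRingEnd (LucasRing P Q)) (omg P Q ^ j) (omgb P Q ^ j)
  rw [starRingEnd_apply] at h
  rw [h, homCyc_symm n hn]
  have h1 : star (omg P Q) = omgb P Q := by ext <;> simp [omg, omgb]
  have h2 : star (omgb P Q) = omg P Q := by rw [← h1, star_star]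
  simp only [map_pow, starRingEnd_apply, h1, h2]

lemma frob (p : ℕ) (hp : p.Prime) (hpD : ¬ (p : ℤ) ∣ (P ^ 2 - 4 * Q)) :
    ((p : LucasRing P Q) ∣ omg P Q ^ p - omg P Q ∧ (p : LucasRing P Q) ∣ omgb P Q ^ p - omgb P Q) ∨
    ((p : LucasRing P Q) ∣ omg P Q ^ p - omgb P Q ∧
      (p : LucasRing P Q) ∣ omgb P Q ^ p - omg P Q) := by
  have : Fact p.Prime := ⟨hp⟩
  let K := AlgebraicClosure (ZMod p)
  have : CharP K p := inferInstance
  have : ExpChar K p := ExpChar.prime hp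
  obtain ⟨a, b, hs, hm⟩ := exists_roots P Q K
  have hz : ∀ c : ℤ, (c : K) = 0 ↔ (p : ℤ) ∣ c := fun c => CharP.intCast_eq_zero_iff K p c
  have hab : a - b ≠ 0 := by
    intro h
    apply hpD
    rw [← hz]
    exact disc_zero P Q a b hs hm h
  have hs' : b + a = (P : K) := by rw [add_comm, hs]
  have hm' : b * a = (Q : K) := by rw [mul_comm, hm]
  have hdvd : ∀ z : LucasRing P Q, lucasEval P Q a b hs hm z = 0 →
      lucasEval P Q b a hs' hm' z = 0 → (p : LucasRing P Q) ∣ z := by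
    intro z h1 h2
    rw [lucasEval_apply] at h1 h2
    have him : (z.im : K) = 0 := by
      have : (z.im : K) * (a - b) = 0 := by linear_combination h1 - h2
      exact (mul_eq_zero.mp this).resolve_right hab
    have hre : (z.re : K) = 0 := by simpa [him] using h1
    rw [hz] at him hre
    have := (QuadraticAlgebra.algebraMap_dvd_iff (R := ℤ) (a := -Q) (b := P) (r := (p : ℤ))
      (z := z)).mpr ⟨hre, him⟩
    simpa using this
  have hPp : (P : K) ^ p = P := by
    have := map_intCast (frobenius K p) P
    rwa [frobenius_def] at this
  have hQp : (Q : K) ^ p = Q := by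
    have := map_intCast (frobenius K p) Q
    rwa [frobenius_def] at this
  have hsp : a ^ p + b ^ p = (P : K) := by rw [← add_pow_expChar, hs, hPp]
  have hmp : a ^ p * b ^ p = (Q : K) := by rw [← mul_pow, hm, hQp]
  have hor : (a ^ p - a) * (a ^ p - b) = 0 := by
    linear_combination hm - hmp + a ^ p * (hsp - hs)
  rcases mul_eq_zero.mp hor with h | h
  · have h' : b ^ p - b = 0 := by linear_combination hsp - hs - h
    left
    constructor <;> apply hdvd <;>
      simp only [map_sub, map_pow, eval_omg, eval_omgb, h, h']
  · have h' : b ^ p - a = 0 := by linear_combination hsp - hs - h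
    right
    constructor <;> apply hdvd <;>
      simp only [map_sub, map_pow, eval_omg, eval_omgb, h, h']

lemma homCyc_step (p : ℕ) (hp : p.Prime) (hpD : ¬ (p : ℤ) ∣ (P ^ 2 - 4 * Q)) (n : ℕ) (hn : 1 < n)
    (k : ℕ) : ((p : LucasRing P Q) ^ (k + 1)) ∣
      homCyc n (omg P Q ^ p ^ (k + 1)) (omgb P Q ^ p ^ (k + 1)) -
      homCyc n (omg P Q ^ p ^ k) (omgb P Q ^ p ^ k) := by
  have e : p ^ (k + 1) = p * p ^ k := pow_succ' p k
  rw [e, pow_mul, pow_mul]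
  rcases frob P Q p hp hpD with ⟨h1, h2⟩ | ⟨h1, h2⟩
  · exact homCyc_congr n _ _ _ _ _ (dvd_sub_pow_of_dvd_sub h1 k) (dvd_sub_pow_of_dvd_sub h2 k)
  · rw [homCyc_symm n hn (omg P Q ^ p ^ k)]
    exact homCyc_congr n _ _ _ _ _ (dvd_sub_pow_of_dvd_sub h1 k) (dvd_sub_pow_of_dvd_sub h2 k)

open Polynomial in
lemma entry (p : ℕ) (hp : p.Prime) (hpD : ¬ (p : ℤ) ∣ (P ^ 2 - 4 * Q))
    (hpPQ : ¬ p ∣ Int.gcd P Q) (n : ℕ) (hn : 1 < n) (hpn : ¬ p ∣ n) (c : ℤ)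
    (hc : homCyc n (omg P Q) (omgb P Q) = (c : LucasRing P Q)) (hpc : (p : ℤ) ∣ c) :
    (p : ℤ) ∣ lucasU P Q n ∧ ∀ m : ℕ, 1 ≤ m → m < n → ¬ (p : ℤ) ∣ lucasU P Q m := by
  have : Fact p.Prime := ⟨hp⟩
  let K := AlgebraicClosure (ZMod p)
  have : CharP K p := inferInstance
  obtain ⟨a, b, hs, hm⟩ := exists_roots P Q K
  have hz : ∀ c : ℤ, (c : K) = 0 ↔ (p : ℤ) ∣ c := fun c => CharP.intCast_eq_zero_iff K p c
  have hab : a - b ≠ 0 := by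
    intro h
    apply hpD
    rw [← hz]
    exact disc_zero P Q a b hs hm h
  have hH : homCyc n a b = 0 := by
    have := congrArg (lucasEval P Q a b hs hm) hc
    rw [homCyc_map, eval_omg, eval_omgb, map_intCast] at this
    rw [this]
    exact (hz c).mpr hpc
  have hb : b ≠ 0 := by
    intro hb
    rw [homCyc_symm n hn] at hH
    have ha : a ≠ 0 := by
      intro ha
      apply hab
      rw [ha, hb, sub_zero]
    rw [homCyc_field _ _ _ ha, hb, zero_div, ← coeff_zero_eq_eval_zero,
      cyclotomic_coeff_zero K hn, mul_one] at hH
    exact pow_ne_zero _ ha hH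
  rw [homCyc_field _ _ _ hb] at hH
  have hr : (cyclotomic n K).IsRoot (a / b) :=
    (mul_eq_zero.mp hH).resolve_left (pow_ne_zero _ hb)
  have : NeZero (n : K) := ⟨by rwa [Ne, CharP.cast_eq_zero_iff K p]⟩
  have hprim := isRoot_cyclotomic_iff.mp hr
  have hU : ∀ m : ℕ, (p : ℤ) ∣ lucasU P Q m ↔ (a / b) ^ m = 1 := by
    intro m
    have h := lucasU_mul P Q a b hs hm m
    rw [← hz, div_pow, div_eq_one_iff_eq (pow_ne_zero _ hb), ← sub_eq_zero (a := a ^ m), ← h]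
    simp [hab]
  refine ⟨(hU n).mpr hprim.pow_eq_one, fun m h1 h2 h3 => ?_⟩
  exact hprim.pow_ne_one_of_pos_of_lt (by omega) h2 ((hU m).mp h3)

end main

theorem stmt_4 (P Q : ℤ) (hP : P ≠ 0) (hQ : Q ≠ 0) (hD : P ^ 2 - 4 * Q ≠ 0)
    (hnd : ∀ m : ℕ, 1 ≤ m → lucasU P Q m ≠ 0)
    (p : ℕ) (hp : p.Prime) (hpD : ¬ (p : ℤ) ∣ (P ^ 2 - 4 * Q))
    (hpPQ : ¬ p ∣ Int.gcd P Q)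
    (n : ℕ) (hn : 1 < n) (hpn : Nat.gcd p n = 1)
    (hz : ¬ ((p : ℤ) ∣ lucasU P Q n ∧
      ∀ m : ℕ, 1 ≤ m → m < n → ¬ (p : ℤ) ∣ lucasU P Q m))
    (k : ℕ) (hk : 1 ≤ k) :
    ∃ t : ℤ, mobiusDualU P Q (p ^ k * n) = 1 + (p : ℚ) ^ k * (t : ℚ) := by
  obtain ⟨k, rfl⟩ : ∃ j, k = j + 1 := ⟨k - 1, by omega⟩
  have hpn' : ¬ p ∣ n := (Nat.Prime.coprime_iff_not_dvd hp).mp hpn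
  have hinj : ∀ (j : ℕ) (c : ℤ), (p : LucasRing P Q) ^ j ∣ (c : LucasRing P Q) →
      (p : ℤ) ^ j ∣ c := by
    intro j c h
    have := (QuadraticAlgebra.algebraMap_dvd_iff (R := ℤ) (a := -Q) (b := P)
      (r := (p : ℤ) ^ j) (z := (c : LucasRing P Q))).mp (by simpa using h)
    simpa using this.1
  choose A hA using fun j => homCyc_int P Q n hn (p ^ j)
  have hstep : ∀ j, (p : ℤ) ^ (j + 1) ∣ A (j + 1) - A j := by
    intro j
    apply hinj
    have := homCyc_step P Q p hp hpD n hn j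
    rw [hA, hA] at this
    push_cast
    exact this
  have h0 : ¬ (p : ℤ) ∣ A 0 := by
    intro h
    have h1 := hA 0
    rw [pow_zero, pow_one, pow_one] at h1
    exact hz (entry P Q p hp hpD hpPQ n hn hpn' _ h1 h)
  have hAj : ∀ j, ¬ (p : ℤ) ∣ A j := by
    intro j
    induction j with
    | zero => exact h0
    | succ j ih =>
      intro h
      apply ih
      have h1 : (p : ℤ) ∣ A (j + 1) - A j := (dvd_pow_self _ (by omega)).trans (hstep j)
      exact (dvd_sub_right h).mp h1
  have hN : 1 < p ^ (k + 1) * n :=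
    lt_of_lt_of_le hn (Nat.le_mul_of_pos_left _ (pow_pos hp.pos _))
  obtain ⟨M, hM⟩ := homCyc_int P Q (p ^ (k + 1) * n) hN 1
  rw [pow_one, pow_one] at hM
  obtain ⟨a, b, hs, hm⟩ := exists_roots P Q ℂ
  have hb : b ≠ 0 := by
    rintro rfl
    rw [mul_zero] at hm
    exact hQ (by exact_mod_cast hm.symm)
  have hMC : homCyc (p ^ (k + 1) * n) a b = (M : ℂ) := by
    have := congrArg (lucasEval P Q a b hs hm) hM
    rwa [homCyc_map, eval_omg, eval_omgb, map_intCast] at this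
  have hAC : ∀ j, homCyc n (a ^ p ^ j) (b ^ p ^ j) = (A j : ℂ) := by
    intro j
    have := congrArg (lucasEval P Q a b hs hm) (hA j)
    rwa [homCyc_map, map_pow, map_pow, eval_omg, eval_omgb, map_intCast] at this
  have hrel : A (k + 1) = M * A k := by
    have := homCyc_expand n p hp hpn' k a b hb
    rw [hAC, hAC, hMC] at this
    exact_mod_cast this
  have hMQ : mobiusDualU P Q (p ^ (k + 1) * n) = (M : ℚ) := by
    have := mobiusDualU_eq P Q hQ hD hnd a b hs hm _ hN
    rw [hMC] at this
    exact_mod_cast this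
  have hd : (p : ℤ) ^ (k + 1) ∣ (M - 1) * A k := by
    have := hstep k
    rw [hrel] at this
    rwa [sub_mul, one_mul]
  have hcop : IsCoprime ((p : ℤ) ^ (k + 1)) (A k) :=
    IsCoprime.pow_left (((Nat.prime_iff_prime_int.mp hp).irreducible.coprime_iff_not_dvd).mpr
      (hAj k))
  obtain ⟨t, ht⟩ := hcop.dvd_of_dvd_mul_right hd
  refine ⟨t, ?_⟩
  rw [hMQ]
  have : M = 1 + (p : ℤ) ^ (k + 1) * t := by linear_combination ht
  rw [this]
  push_cast
  ring
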